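/- Let R be a commutative ring, ℓ ∈ ℕ, and p, q ∈ ℤ. Let g_{k,j} ∈ R for all k, j ∈ ℤ with g_{k,j} = 0 whenever k < 0. For m ∈ ℕ and μ, β ∈ ℤ^m, define s_{μ,β} := det((g_{μ_i + j - i, β_i + j - i})_{i,j ∈ [m]}). Let μ ∈ ℤ^{ℓ+1} with μ_{ℓ+1} = 0, set μ̄ = (μ_1,…,μ_ℓ); let β ∈ ℤ^ℓ and β' = (β_1,…,β_ℓ, q - p) ∈ ℤ^{ℓ+1}. Then g_{p,q} · s_{μ̄, β} = Σ_{δ ∈ ℕ^{ℓ+1}, |δ| = p} s_{μ+δ, β'+δ}. -/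

import Mathlib

open Finset in
/-- The coefficient form of `h_p * Δ = a_{(p) + ρ}` for `Δ` the Vandermonde determinant, with the
shifts acting on the columns. -/
theorem sum_piAntidiag_det_column_shift {R : Type*} [CommRing R] (n P : ℕ)
    (a : Fin (n + 1) → ℕ → R) :
    ∑ δ ∈ piAntidiag (univ : Finset (Fin (n + 1))) P,
        Matrix.det (Matrix.of fun i j : Fin (n + 1) => a i (δ j + j))
      = Matrix.det (Matrix.of fun i j : Fin (n + 1) =>
          a i (if j = Fin.last n then n + P else j)) := by
  set V : (Fin (n + 1) → ℕ) → R := fun e => Matrix.det (Matrix.of fun i j => a i (e j)) with hV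
  have V_zero (e : Fin (n + 1) → ℕ) (x y : Fin (n + 1)) (hxy : x ≠ y) (h : e x = e y) :
      V e = 0 := Matrix.det_zero_of_column_eq hxy fun i => by simp [h]
  have V_swap (e : Fin (n + 1) → ℕ) (x y : Fin (n + 1)) (hxy : x ≠ y) :
      V (e ∘ Equiv.swap x y) = - V e := by
    have := Matrix.det_permute' (Equiv.swap x y) (Matrix.of fun i j => a i (e j))
    rw [Equiv.Perm.sign_swap hxy] at this
    simpa [hV, Matrix.submatrix] using this
  set E : Finset (Fin (n + 1) → ℕ) :=
    (piAntidiag univ P).image fun δ (j : Fin (n + 1)) => δ j + (j : ℕ) with hE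
  have mem_E (e : Fin (n + 1) → ℕ) :
      e ∈ E ↔ (∀ j : Fin (n + 1), (j : ℕ) ≤ e j) ∧ ∑ j, e j = P + ∑ j : Fin (n + 1), (j : ℕ) := by
    simp only [hE, mem_image, mem_piAntidiag]
    constructor
    · rintro ⟨δ, ⟨hδ, -⟩, rfl⟩
      exact ⟨fun j => Nat.le_add_left _ _, by rw [sum_add_distrib, hδ]⟩
    · rintro ⟨h1, h2⟩
      refine ⟨fun j => e j - j, ⟨?_, by simp⟩, funext fun j => Nat.sub_add_cancel (h1 j)⟩
      have : ∑ j, (e j - (j : ℕ)) + ∑ j : Fin (n + 1), (j : ℕ) = ∑ j, e j := by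
        rw [← sum_add_distrib]
        exact sum_congr rfl fun j _ => Nat.sub_add_cancel (h1 j)
      omega
  have sum_E : ∑ δ ∈ piAntidiag (univ : Finset (Fin (n + 1))) P, V (fun j => δ j + (j : ℕ))
      = ∑ e ∈ E, V e := by
    rw [hE, sum_image]
    intro x _ y _ h
    funext j
    exact Nat.add_right_cancel (congrFun h j)
  -- Terms whose exponents at the positions in `[k, n)` are not minimal cancel in pairs.
  have reduce (k : ℕ) (hk : k ≤ n) : ∑ e ∈ E, V e =
      ∑ e ∈ E with ∀ j : Fin (n + 1), k ≤ j → (j : ℕ) < n → e j = (j : ℕ), V e := by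
    induction hk using Nat.decreasingInduction with
    | self =>
      rw [filter_true_of_mem]
      intro e _ j h1 h2
      omega
    | of_succ k hk ih =>
      rw [ih]
      let x : Fin (n + 1) := ⟨k, by omega⟩
      have hx : x ≠ Fin.last n := by simp [x, Fin.ext_iff]; omega
      rw [← sum_filter_add_sum_filter_not _ (fun e => e x = k)]
      have cancel : ∑ e ∈ E with (∀ j : Fin (n + 1), k + 1 ≤ j → (j : ℕ) < n → e j = (j : ℕ)) ∧
          ¬ e x = k ∧ n ≤ e x, V e = 0 := by
        refine sum_involution (fun e _ => e ∘ Equiv.swap x (Fin.last n)) ?_ ?_ ?_ ?_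
        · intro e _
          rw [V_swap e _ _ hx, add_neg_cancel]
        · intro e _ hne h
          refine hne (V_zero e _ _ hx ?_)
          simpa using (congrFun h x).symm
        · intro e he
          simp only [mem_filter, mem_E] at he ⊢
          obtain ⟨⟨h1, h2⟩, h3, h4, h5⟩ := he
          have hn : n ≤ e (Fin.last n) := by simpa using h1 (Fin.last n)
          refine ⟨⟨fun j => ?_, ?_⟩, fun j hj1 hj2 => ?_, ?_, ?_⟩
          · by_cases hjx : j = x
            · subst hjx
              simp only [Function.comp_apply, Equiv.swap_apply_left]
              exact hk.le.trans hn
            · by_cases hjl : j = Fin.last n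
              · subst hjl
                simpa using h5
              · simpa [Equiv.swap_apply_of_ne_of_ne hjx hjl] using h1 j
          · rw [← h2]
            exact Equiv.sum_comp (Equiv.swap x (Fin.last n)) e
          · have hjx : j ≠ x := by simp only [x, ne_eq, Fin.ext_iff]; omega
            have hjl : j ≠ Fin.last n := by simp only [ne_eq, Fin.ext_iff, Fin.val_last]; omega
            simpa [Equiv.swap_apply_of_ne_of_ne hjx hjl] using h3 j hj1 hj2
          · simp only [Function.comp_apply, Equiv.swap_apply_left]
            omega
          · simpa using hn
        · intro e _
          funext j
          simp
      have rest : ∑ e ∈ {e ∈ E | ∀ j : Fin (n + 1), k + 1 ≤ j → (j : ℕ) < n → e j = (j : ℕ)} with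
          ¬ e x = k, V e = 0 := by
        rw [← cancel]
        symm
        refine sum_subset ?_ ?_
        · intro e he
          simp only [mem_filter] at he ⊢
          tauto
        · intro e he hne
          simp only [mem_filter] at he hne
          obtain ⟨⟨he1, he2⟩, he3⟩ := he
          have hlt : e x < n := by
            by_contra! h
            exact hne ⟨he1, he2, he3, h⟩
          have hkx : k ≤ e x := ((mem_E e).1 he1).1 x
          refine V_zero e x ⟨e x, by omega⟩ ?_ ?_
          · simp only [x, ne_eq, Fin.ext_iff]
            exact fun h => he3 h.symm
          · exact (he2 ⟨e x, by omega⟩ (by simp only; omega) hlt).symm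
      rw [rest, add_zero, filter_filter]
      congr 1
      refine filter_congr fun e _ => ⟨fun h j hj1 hj2 => ?_, fun h =>
        ⟨fun j hj1 hj2 => h j (by omega) hj2, h x le_rfl hk⟩⟩
      rcases hj1.eq_or_lt with hj | hj
      · obtain rfl : x = j := Fin.ext hj
        exact h.2
      · exact h.1 j hj hj2
  change ∑ δ ∈ piAntidiag (univ : Finset (Fin (n + 1))) P, V (fun j => δ j + (j : ℕ)) =
    V fun j : Fin (n + 1) => if j = Fin.last n then n + P else (j : ℕ)
  rw [sum_E, reduce 0 (Nat.zero_le n), ← sum_singleton V]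
  congr 1
  ext e
  simp only [mem_filter, mem_E, mem_singleton, Nat.zero_le, true_imp_iff]
  have hsum : ∑ j : Fin (n + 1), (j : ℕ) = ∑ j : Fin n, (j : ℕ) + n := by
    simp [Fin.sum_univ_castSucc]
  constructor
  · rintro ⟨⟨-, h2⟩, h3⟩
    funext j
    induction j using Fin.lastCases with
    | last =>
      have : ∑ j : Fin n, e j.castSucc = ∑ j : Fin n, (j : ℕ) :=
        sum_congr rfl fun j _ => h3 j.castSucc j.isLt
      rw [Fin.sum_univ_castSucc, this] at h2
      simp only [if_true]
      omega
    | cast j => simpa [(Fin.castSucc_lt_last j).ne] using h3 j.castSucc j.isLt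
  · rintro rfl
    refine ⟨⟨fun j => ?_, ?_⟩, fun j hj => ?_⟩
    · dsimp only
      split_ifs <;> omega
    · rw [hsum, Fin.sum_univ_castSucc]
      simp [(Fin.castSucc_lt_last _).ne]
      omega
    · dsimp only
      rw [if_neg]
      simp only [Fin.ext_iff, Fin.val_last]
      omega

open Finset in
/-- Summed over all compositions, row shifts and column shifts of a determinant agree. -/
theorem sum_piAntidiag_det_row_shift {R : Type*} [CommRing R] (n P : ℕ)
    (a : Fin n → ℕ → R) :
    ∑ δ ∈ piAntidiag (univ : Finset (Fin n)) P,
        Matrix.det (Matrix.of fun i j : Fin n => a i (δ i + j))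
      = ∑ δ ∈ piAntidiag (univ : Finset (Fin n)) P,
        Matrix.det (Matrix.of fun i j : Fin n => a i (δ j + j)) := by
  simp only [Matrix.det_apply, Matrix.of_apply]
  rw [sum_comm, sum_comm (s := piAntidiag _ _)]
  refine sum_congr rfl fun σ _ => ?_
  refine sum_nbij' (fun δ => δ ∘ σ) (fun δ => δ ∘ σ.symm) ?_ ?_ ?_ ?_ ?_
  · intro δ hδ
    simp only [mem_piAntidiag, mem_univ, implies_true, and_true] at hδ ⊢
    rw [← hδ]
    exact Equiv.sum_comp σ δ
  · intro δ hδ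
    simp only [mem_piAntidiag, mem_univ, implies_true, and_true] at hδ ⊢
    rw [← hδ]
    exact Equiv.sum_comp σ.symm δ
  · intro δ _
    funext j
    simp
  · intro δ _
    funext j
    simp
  · intro δ _
    simp

/-- Expansion of a determinant along a last row with a single nonzero entry, the last one. -/
theorem Matrix.det_eq_mul_of_last_row {R : Type*} [CommRing R] {n : ℕ}
    (M : Matrix (Fin (n + 1)) (Fin (n + 1)) R) (hM : ∀ j : Fin n, M (Fin.last n) j.castSucc = 0) :
    M.det = M (Fin.last n) (Fin.last n) * (M.submatrix Fin.castSucc Fin.castSucc).det := by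
  rw [Matrix.det_succ_row M (Fin.last n), Fin.sum_univ_castSucc]
  simp [hM, Fin.succAbove_last, ← two_mul]


/-- Pieri-type rule for Macdonald's 9th-variation Schur functions
s_{μ,β} := det((g_{μ_i+j-i, β_i+j-i})): if g_{k,j} = 0 for k < 0, μ ∈ ℤ^{ℓ+1} has
μ_{ℓ+1} = 0, μ̄ = (μ_1,…,μ_ℓ), β ∈ ℤ^ℓ and β' = (β_1,…,β_ℓ, q-p), then
g_{p,q} · s_{μ̄,β} = Σ_{δ ∈ ℕ^{ℓ+1}, |δ| = p} s_{μ+δ, β'+δ}. -/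
theorem fun_pieri {R : Type*} [CommRing R] (ℓ : ℕ) (p q : ℤ)
    (g : ℤ → ℤ → R) (hg : ∀ k : ℤ, k < 0 → ∀ j : ℤ, g k j = 0)
    (μ : Fin (ℓ + 1) → ℤ) (hμ : μ (Fin.last ℓ) = 0)
    (β : Fin ℓ → ℤ) :
    g p q
        * Matrix.det (Matrix.of fun i j : Fin ℓ =>
            g (μ i.castSucc + ((j : ℕ) : ℤ) - ((i : ℕ) : ℤ))
              (β i + ((j : ℕ) : ℤ) - ((i : ℕ) : ℤ)))
      = ∑ᶠ (δ : Fin (ℓ + 1) → ℕ) (_ : ∑ i, (δ i : ℤ) = p),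
          Matrix.det (Matrix.of fun i j : Fin (ℓ + 1) =>
            g (μ i + (δ i : ℤ) + ((j : ℕ) : ℤ) - ((i : ℕ) : ℤ))
              ((Fin.snoc β (q - p) : Fin (ℓ + 1) → ℤ) i + (δ i : ℤ) + ((j : ℕ) : ℤ) - ((i : ℕ) : ℤ))) := by
  rcases lt_or_ge p 0 with hp | hp
  · have hempty (δ : Fin (ℓ + 1) → ℕ) : ¬ ∑ i, (δ i : ℤ) = p :=
      (hp.trans_le (Finset.sum_nonneg fun i _ => Int.natCast_nonneg (δ i))).ne'
    simp [hempty, hg p hp]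
  lift p to ℕ using hp with P
  have hmem (δ : Fin (ℓ + 1) → ℕ) :
      ∑ i, (δ i : ℤ) = P ↔ δ ∈ Finset.piAntidiag (Finset.univ : Finset (Fin (ℓ + 1))) P := by
    simp only [Finset.mem_piAntidiag, Finset.mem_univ, implies_true, and_true]
    norm_cast
  simp only [hmem]
  rw [finsum_mem_finset_eq_sum]
  let b : Fin (ℓ + 1) → ℤ := Fin.snoc β (q - P)
  let a : Fin (ℓ + 1) → ℕ → R := fun i t => g (μ i + t - (i : ℕ)) (b i + t - (i : ℕ))
  trans ∑ δ ∈ Finset.piAntidiag (Finset.univ : Finset (Fin (ℓ + 1))) P,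
      Matrix.det (Matrix.of fun i j : Fin (ℓ + 1) => a i (δ i + j))
  · rw [sum_piAntidiag_det_row_shift, sum_piAntidiag_det_column_shift,
      Matrix.det_eq_mul_of_last_row]
    · congr 1
      · simp only [Matrix.of_apply, a, b, if_true, hμ, Fin.snoc_last, Fin.val_last]
        congr 1 <;> push_cast <;> ring
      · congr 1
        ext i j
        simp [a, b, (Fin.castSucc_lt_last j).ne]
    · intro j
      simp only [Matrix.of_apply, a, (Fin.castSucc_lt_last j).ne, if_false, hμ]
      refine hg _ ?_ _
      simp only [Fin.val_castSucc, Fin.val_last]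
      omega
  · refine Finset.sum_congr rfl fun δ _ => ?_
    congr 1
    ext i j
    simp only [Matrix.of_apply, a, b]
    congr 1 <;> push_cast <;> ring
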